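/- Let p ≥ 2 be an integer, let −1 = t_0 < t_1 < ⋯ < t_p = 1 be the Gauß–Lobatto points of order p, and let t*_{p+1} ∈ (−1,1) be any point distinct from t_0,…,t_p. Let Î*_{p+1} : C([−1,1]²) → Q_{p+1}(τ̂) be the Lagrange interpolation operator at the tensor grid of the p + 2 nodes {t_0,…,t_p, t*_{p+1}}. Then for every continuous function v on τ̂ = [−1,1]²: Î_p v = π̂_p (Î*_{p+1} v), where π̂_p is the vertex-edge-cell interpolant into Q_p(τ̂) and Î_p the Gauß–Lobatto interpolant into Q_p(τ̂). -/

import Mathlib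

/-- The Legendre polynomial of degree `p`, given by Rodrigues' formula
`L_p(t) = (1/(2^p p!)) (d/dt)^p (t² − 1)^p`. -/
noncomputable def legendre (p : ℕ) : Polynomial ℝ :=
  Polynomial.C (1 / (2 ^ p * (Nat.factorial p) : ℝ)) *
    Polynomial.derivative^[p] ((Polynomial.X ^ 2 - 1) ^ p)

/-- The Gauß–Lobatto points of order `p`: `−1 = t_0 < t_1 < ⋯ < t_p = 1`, the zeros of
`(1 − t²) L_p'(t)`. -/
def IsGLNodes (p : ℕ) (t : Fin (p + 1) → ℝ) : Prop :=
  StrictMono t ∧ t 0 = -1 ∧ t (Fin.last p) = 1 ∧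
    ∀ i, (1 - t i ^ 2) * (Polynomial.derivative (legendre p)).eval (t i) = 0

/-- Evaluation of a bivariate polynomial at a point of `ℝ²`. -/
noncomputable def ev (q : MvPolynomial (Fin 2) ℝ) (z : ℝ × ℝ) : ℝ :=
  MvPolynomial.eval ![z.1, z.2] q

/-- `q ∈ Q_k`: degree at most `k` in each of the two variables. -/
def memQ (k : ℕ) (q : MvPolynomial (Fin 2) ℝ) : Prop :=
  q.degreeOf 0 ≤ k ∧ q.degreeOf 1 ≤ k

/-- The reference element `τ̂ = [−1,1]²`. -/
def refSq : Set (ℝ × ℝ) := Set.Icc (-1, -1) (1, 1)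

/-- `q` is the vertex-edge-cell interpolant of `v` into `Q_k(τ̂)`: it matches `v` at the
four vertices of `τ̂ = [−1,1]²`, has the same moments against `P_{k−2}` on each of the
four edges, and the same moments against `Q_{k−2}` on the cell. -/
def IsVEC (k : ℕ) (v : ℝ × ℝ → ℝ) (q : MvPolynomial (Fin 2) ℝ) : Prop :=
  memQ k q ∧
  (∀ a ∈ ({-1, 1} : Set ℝ), ∀ b ∈ ({-1, 1} : Set ℝ), ev q (a, b) = v (a, b)) ∧
  (∀ b ∈ ({-1, 1} : Set ℝ), ∀ r : Polynomial ℝ, r.natDegree ≤ k - 2 →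
    ∫ s in (-1 : ℝ)..1, (ev q (s, b) - v (s, b)) * r.eval s = 0) ∧
  (∀ a ∈ ({-1, 1} : Set ℝ), ∀ r : Polynomial ℝ, r.natDegree ≤ k - 2 →
    ∫ s in (-1 : ℝ)..1, (ev q (a, s) - v (a, s)) * r.eval s = 0) ∧
  (∀ r : MvPolynomial (Fin 2) ℝ, memQ (k - 2) r →
    ∫ x in (-1 : ℝ)..1, ∫ y in (-1 : ℝ)..1, (ev q (x, y) - v (x, y)) * ev r (x, y) = 0)

/-- `q ∈ Q_k(τ̂)` is the tensor-product Lagrange interpolant of `v` at the grid of the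
nodes `s_0,…,s_k`. -/
def IsLag (k : ℕ) (s : Fin (k + 1) → ℝ) (v : ℝ × ℝ → ℝ) (q : MvPolynomial (Fin 2) ℝ) :
    Prop :=
  memQ k q ∧ ∀ i j, ev q (s i, s j) = v (s i, s j)

open Polynomial in
/-- The moment functional `u ↦ ∫_{-1}^{1} u r`. -/
noncomputable def moment (r : ℝ[X]) : ℝ[X] →ₗ[ℝ] ℝ where
  toFun u := ∫ s in (-1 : ℝ)..1, u.eval s * r.eval s
  map_add' u w := by
    rw [← intervalIntegral.integral_add]
    · simp only [eval_add, add_mul]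
    all_goals exact Continuous.intervalIntegrable (by fun_prop) _ _
  map_smul' c u := by
    simp only [eval_smul, smul_eq_mul, RingHom.id_apply, mul_assoc]
    exact intervalIntegral.integral_const_mul _ _

open Polynomial in
/-- The functionals defining the univariate analogue of the vertex-edge-cell interpolant:
the values at `±1` and the moments against polynomials of degree at most `k - 2`. -/
def IsDof (k : ℕ) (l : ℝ[X] →ₗ[ℝ] ℝ) : Prop :=
  (∃ a ∈ ({-1, 1} : Set ℝ), l = leval a) ∨ ∃ r : ℝ[X], r.natDegree ≤ k - 2 ∧ l = moment r

section Univariate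

open Polynomial

lemma moment_apply (r u : ℝ[X]) :
    moment r u = ∫ s in (-1 : ℝ)..1, u.eval s * r.eval s := rfl

lemma moment_derivative (r u : ℝ[X]) (h₁ : (u * r).eval 1 = 0) (h₂ : (u * r).eval (-1) = 0) :
    moment r (derivative u) = -moment (derivative r) u := by
  have key := intervalIntegral.integral_deriv_mul_eq_sub (a := (-1 : ℝ)) (b := 1)
    (u := fun s => u.eval s) (v := fun s => r.eval s)
    (u' := fun s => (derivative u).eval s) (v' := fun s => (derivative r).eval s)
    (fun x _ => u.hasDerivAt x) (fun x _ => r.hasDerivAt x)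
    (Continuous.intervalIntegrable (by fun_prop) _ _)
    (Continuous.intervalIntegrable (by fun_prop) _ _)
  rw [intervalIntegral.integral_add (Continuous.intervalIntegrable (by fun_prop) _ _)
    (Continuous.intervalIntegrable (by fun_prop) _ _)] at key
  rw [eval_mul] at h₁ h₂
  rw [moment_apply, moment_apply]
  linarith

lemma eval_iterate_derivative_sq_sub_one_pow {p n : ℕ} (hn : n < p) {a : ℝ}
    (ha : a ∈ ({-1, 1} : Set ℝ)) :
    (derivative^[n] ((X ^ 2 - 1 : ℝ[X]) ^ p)).eval a = 0 := by
  have h : (X - C a) ∣ (X ^ 2 - 1 : ℝ[X]) := by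
    rw [dvd_iff_isRoot]
    rcases ha with rfl | rfl <;> simp
  have h' := pow_sub_dvd_iterate_derivative_of_pow_dvd n (pow_dvd_pow_of_dvd h p)
  exact dvd_iff_isRoot.mp ((dvd_pow_self _ (by lia)).trans h')

lemma moment_iterate_derivative_sq_sub_one_pow (p n : ℕ) (hn : n ≤ p) (r : ℝ[X])
    (hr : derivative^[n] r = 0) :
    moment r (derivative^[n] ((X ^ 2 - 1 : ℝ[X]) ^ p)) = 0 := by
  induction n generalizing r with
  | zero =>
    have : r = 0 := hr
    simp [moment_apply, this]
  | succ n ih =>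
    have hv := fun a ha => eval_iterate_derivative_sq_sub_one_pow (p := p) (n := n) (a := a) hn ha
    rw [Function.iterate_succ_apply', moment_derivative, ih (by lia) _ hr, neg_zero]
    · rw [eval_mul, hv 1 (by simp), zero_mul]
    · rw [eval_mul, hv (-1) (by simp), zero_mul]

lemma moment_legendre {p : ℕ} {r : ℝ[X]} (hr : r.natDegree < p) : moment r (legendre p) = 0 := by
  rw [legendre, ← smul_eq_C_mul, map_smul,
    moment_iterate_derivative_sq_sub_one_pow p p le_rfl r (iterate_derivative_eq_zero hr),
    smul_zero]

lemma moment_mul (r u w : ℝ[X]) : moment r (w * u) = moment (w * r) u := by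
  simp only [moment_apply, eval_mul]
  congr 1
  ext s
  ring

lemma moment_one_sub_sq_mul_derivative_legendre {p : ℕ} (hp : 2 ≤ p) {r : ℝ[X]}
    (hr : r.natDegree ≤ p - 2) :
    moment r ((1 - X ^ 2) * derivative (legendre p)) = 0 := by
  rw [moment_mul, moment_derivative _ _ (by simp) (by simp), moment_legendre, neg_zero]
  have h : ((1 - X ^ 2) * r : ℝ[X]).natDegree ≤ 2 + (p - 2) :=
    natDegree_mul_le_of_le (by compute_degree) hr
  exact (natDegree_derivative_le _).trans_lt (by lia)

lemma natDegree_legendre_le (p : ℕ) : (legendre p).natDegree ≤ p := by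
  refine (natDegree_C_mul_le _ _).trans ((natDegree_iterate_derivative _ _).trans ?_)
  have : ((X ^ 2 - 1 : ℝ[X]) ^ p).natDegree ≤ p * 2 :=
    natDegree_pow_le_of_le p (by compute_degree)
  lia

lemma coeff_legendre_ne_zero (p : ℕ) : (legendre p).coeff p ≠ 0 := by
  have hm : (X ^ 2 - 1 : ℝ[X]).Monic := by monicity!
  have hd : (X ^ 2 - 1 : ℝ[X]).natDegree = 2 := by compute_degree!
  have hc : ((X ^ 2 - 1 : ℝ[X]) ^ p).coeff (p + p) = 1 := by
    have := (hm.pow p).coeff_natDegree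
    rwa [hm.natDegree_pow, hd, mul_two] at this
  rw [legendre, coeff_C_mul, coeff_iterate_derivative, hc]
  have : (p + p).descFactorial p ≠ 0 := by
    rw [Ne, Nat.descFactorial_eq_zero_iff_lt]; lia
  have := Nat.factorial_ne_zero p
  simp [*]

lemma exists_eq_C_mul_one_sub_sq_mul_derivative_legendre {p : ℕ} (hp : 2 ≤ p)
    {t : Fin (p + 1) → ℝ} (ht : IsGLNodes p t) {u : ℝ[X]} (hu : u.natDegree ≤ p + 1)
    (h0 : ∀ i, u.eval (t i) = 0) :
    ∃ c : ℝ, u = c • ((1 - X ^ 2) * derivative (legendre p)) := by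
  set g : ℝ[X] := (1 - X ^ 2) * derivative (legendre p) with hg
  have hd : (derivative (legendre p)).natDegree ≤ p - 1 :=
    (natDegree_derivative_le _).trans (Nat.sub_le_sub_right (natDegree_legendre_le p) 1)
  have hgd : g.natDegree ≤ p + 1 := by
    have : g.natDegree ≤ 2 + (p - 1) := natDegree_mul_le_of_le (by compute_degree) hd
    lia
  have hgc : g.coeff (p + 1) ≠ 0 := by
    obtain ⟨m, rfl⟩ : ∃ m, p = m + 1 := ⟨p - 1, by lia⟩
    rw [hg, sub_mul, one_mul, coeff_sub, coeff_X_pow_mul,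
      coeff_eq_zero_of_natDegree_lt (by lia), coeff_derivative, zero_sub, neg_ne_zero]
    exact mul_ne_zero (coeff_legendre_ne_zero _) (by positivity)
  refine ⟨u.coeff (p + 1) / g.coeff (p + 1), sub_eq_zero.mp ?_⟩
  refine eq_zero_of_natDegree_lt_card_of_eval_eq_zero _ ht.1.injective (fun i => ?_) ?_
  · have := ht.2.2.2 i
    simp [h0, hg, this]
  · rw [Fintype.card_fin]
    refine lt_of_le_of_ne ((natDegree_sub_le_of_le hu
      ((natDegree_smul_le _ _).trans hgd)).trans (max_self _).le) fun h => ?_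
    have hz : (u - (u.coeff (p + 1) / g.coeff (p + 1)) • g).coeff (p + 1) = 0 := by
      simp [hgc]
    generalize u - (u.coeff (p + 1) / g.coeff (p + 1)) • g = w at h hz
    rw [← h, coeff_natDegree, leadingCoeff_eq_zero] at hz
    simp [hz] at h

lemma IsDof.apply_eq_zero_of_eval_nodes {p : ℕ} (hp : 2 ≤ p) {t : Fin (p + 1) → ℝ}
    (ht : IsGLNodes p t) {l : ℝ[X] →ₗ[ℝ] ℝ} (hl : IsDof p l) {u : ℝ[X]}
    (hu : u.natDegree ≤ p + 1) (h0 : ∀ i, u.eval (t i) = 0) : l u = 0 := by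
  rcases hl with ⟨a, rfl | rfl, rfl⟩ | ⟨r, hr, rfl⟩
  · simpa [ht.2.1] using h0 0
  · simpa [ht.2.2.1] using h0 (Fin.last p)
  · obtain ⟨c, rfl⟩ := exists_eq_C_mul_one_sub_sq_mul_derivative_legendre hp ht hu h0
    rw [map_smul, moment_one_sub_sq_mul_derivative_legendre hp hr, smul_zero]

lemma eq_zero_of_isDof {p : ℕ} {u : ℝ[X]} (hu : u.natDegree ≤ p)
    (h : ∀ l, IsDof p l → l u = 0) : u = 0 := by
  have h₁ : u.IsRoot 1 := h (leval 1) (.inl ⟨1, by simp, rfl⟩)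
  have h₂ : u.IsRoot (-1) := h (leval (-1)) (.inl ⟨-1, by simp, rfl⟩)
  obtain ⟨w, rfl⟩ := dvd_iff_isRoot.mpr h₁
  have h₃ : w.IsRoot (-1) := by
    rw [IsRoot, eval_mul] at h₂
    refine (mul_eq_zero.mp h₂).resolve_left ?_
    norm_num
  obtain ⟨r, rfl⟩ := dvd_iff_isRoot.mpr h₃
  by_cases hr0 : r = 0
  · simp [hr0]
  have hr : r.natDegree ≤ p - 2 := by
    rw [natDegree_mul (X_sub_C_ne_zero _) (mul_ne_zero (X_sub_C_ne_zero _) hr0),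
      natDegree_mul (X_sub_C_ne_zero _) hr0, natDegree_X_sub_C, natDegree_X_sub_C] at hu
    lia
  have hm := h (moment (-r)) (.inr ⟨-r, by simpa using hr, rfl⟩)
  obtain ⟨c, hc, hrc⟩ : ∃ c ∈ Set.Ioo (-1 : ℝ) 1, r.eval c ≠ 0 := by
    by_contra! hcon
    exact hr0 (eq_zero_of_infinite_isRoot r
      ((Set.Ioo_infinite (by norm_num : (-1 : ℝ) < 1)).mono hcon))
  refine absurd hm (ne_of_gt ?_)
  rw [moment_apply]
  have hs (s : ℝ) : ((X - C 1) * ((X - C (-1)) * r) : ℝ[X]).eval s * (-r).eval s =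
      (1 - s) * (1 + s) * r.eval s ^ 2 := by
    simp only [eval_mul, eval_sub, eval_X, eval_C, eval_neg]; ring
  simp only [hs]
  refine intervalIntegral.integral_pos (by norm_num) (by fun_prop) (fun s hs => ?_)
    ⟨c, Set.Ioo_subset_Icc_self hc, ?_⟩
  · exact mul_nonneg (mul_nonneg (by linarith [hs.2]) (by linarith [hs.1])) (sq_nonneg _)
  · exact mul_pos (mul_pos (by linarith [hc.2]) (by linarith [hc.1])) (by positivity)

end Univariate

section Bivariate

open Polynomial

/-- The univariate polynomial `y ↦ q (x, y)`. -/
noncomputable def slice (q : MvPolynomial (Fin 2) ℝ) (x : ℝ) : ℝ[X] :=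
  ∑ m ∈ q.support, monomial (m 1) (q.coeff m * x ^ m 0)

/-- The univariate polynomial `x ↦ l (q (x, ·))`. -/
noncomputable def marginal (l : ℝ[X] →ₗ[ℝ] ℝ) (q : MvPolynomial (Fin 2) ℝ) : ℝ[X] :=
  ∑ m ∈ q.support, monomial (m 0) (q.coeff m * l (X ^ m 1))

lemma eval_slice (q : MvPolynomial (Fin 2) ℝ) (x y : ℝ) : (slice q x).eval y = ev q (x, y) := by
  simp [slice, ev, eval_finsetSum, MvPolynomial.eval_eq', mul_assoc]

lemma eval_marginal (l : ℝ[X] →ₗ[ℝ] ℝ) (q : MvPolynomial (Fin 2) ℝ) (x : ℝ) :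
    (marginal l q).eval x = l (slice q x) := by
  simp only [marginal, slice, eval_finsetSum, eval_monomial, map_sum]
  refine Finset.sum_congr rfl fun m _ => ?_
  rw [← C_mul_X_pow_eq_monomial, ← smul_eq_C_mul, map_smul, smul_eq_mul]
  ring

lemma natDegree_slice_le {k : ℕ} {q : MvPolynomial (Fin 2) ℝ} (hq : memQ k q) (x : ℝ) :
    (slice q x).natDegree ≤ k :=
  natDegree_sum_le_of_forall_le _ _ fun m hm =>
    (natDegree_monomial_le _).trans (MvPolynomial.degreeOf_le_iff.mp hq.2 m hm)

lemma natDegree_marginal_le {k : ℕ} {q : MvPolynomial (Fin 2) ℝ} (hq : memQ k q)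
    (l : ℝ[X] →ₗ[ℝ] ℝ) : (marginal l q).natDegree ≤ k :=
  natDegree_sum_le_of_forall_le _ _ fun m hm =>
    (natDegree_monomial_le _).trans (MvPolynomial.degreeOf_le_iff.mp hq.1 m hm)

lemma ev_sub (q r : MvPolynomial (Fin 2) ℝ) (z : ℝ × ℝ) : ev (q - r) z = ev q z - ev r z :=
  map_sub _ _ _

lemma slice_sub (q r : MvPolynomial (Fin 2) ℝ) (x : ℝ) :
    slice (q - r) x = slice q x - slice r x :=
  Polynomial.funext fun y => by simp only [eval_sub, eval_slice, ev_sub]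

lemma marginal_sub (l : ℝ[X] →ₗ[ℝ] ℝ) (q r : MvPolynomial (Fin 2) ℝ) :
    marginal l (q - r) = marginal l q - marginal l r :=
  Polynomial.funext fun x => by simp only [eval_sub, eval_marginal, slice_sub, map_sub]

lemma memQ.mono {k n : ℕ} (h : k ≤ n) {q : MvPolynomial (Fin 2) ℝ} (hq : memQ k q) : memQ n q :=
  ⟨hq.1.trans h, hq.2.trans h⟩

lemma memQ.sub {k : ℕ} {q r : MvPolynomial (Fin 2) ℝ} (hq : memQ k q) (hr : memQ k r) :
    memQ k (q - r) :=
  ⟨(MvPolynomial.degreeOf_sub_le _ _ _).trans (max_le hq.1 hr.1),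
    (MvPolynomial.degreeOf_sub_le _ _ _).trans (max_le hq.2 hr.2)⟩

lemma ev_aeval_mul_aeval (r s : ℝ[X]) (x y : ℝ) :
    ev (aeval (MvPolynomial.X 0) r * aeval (MvPolynomial.X 1) s) (x, y) =
      r.eval x * s.eval y := by
  have h (i : Fin 2) (f : ℝ[X]) :
      MvPolynomial.eval ![x, y] (aeval (MvPolynomial.X i) f) = f.eval (![x, y] i) := by
    rw [← MvPolynomial.coe_aeval_eq_eval, RingHom.coe_coe, ← aeval_algHom_apply]
    simp [coe_aeval_eq_eval]
  simp [ev, h]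

lemma degreeOf_aeval_X_le (i j : Fin 2) (f : ℝ[X]) :
    (aeval (MvPolynomial.X i : MvPolynomial (Fin 2) ℝ) f).degreeOf j ≤
      if j = i then f.natDegree else 0 := by
  rw [aeval_eq_sum_range]
  refine (MvPolynomial.degreeOf_sum_le _ _ _).trans (Finset.sup_le fun n hn => ?_)
  rw [MvPolynomial.smul_eq_C_mul]
  refine (MvPolynomial.degreeOf_C_mul_le _ _ _).trans
    ((MvPolynomial.degreeOf_pow_le _ _ _).trans ?_)
  rw [MvPolynomial.degreeOf_X]
  split_ifs <;> simp_all

lemma memQ_aeval_mul_aeval {k : ℕ} {r s : ℝ[X]} (hr : r.natDegree ≤ k) (hs : s.natDegree ≤ k) :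
    memQ k (aeval (MvPolynomial.X 0) r * aeval (MvPolynomial.X 1) s) := by
  constructor <;> refine (MvPolynomial.degreeOf_mul_le _ _ _).trans
    ((add_le_add (degreeOf_aeval_X_le _ _ _) (degreeOf_aeval_X_le _ _ _)).trans ?_) <;> simpa

lemma IsVEC.apply_marginal_sub_eq_zero {p : ℕ} {q w : MvPolynomial (Fin 2) ℝ}
    (h : IsVEC p (ev w) q) {l m : ℝ[X] →ₗ[ℝ] ℝ} (hl : IsDof p l) (hm : IsDof p m) :
    l (marginal m (q - w)) = 0 := by
  obtain ⟨-, hv, hh, hvert, hc⟩ := h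
  rcases hl with ⟨a, ha, rfl⟩ | ⟨r, hr, rfl⟩ <;> rcases hm with ⟨b, hb, rfl⟩ | ⟨s, hs, rfl⟩
  · simp [eval_marginal, eval_slice, ev_sub, hv a ha b hb]
  · simpa [eval_marginal, moment_apply, eval_slice, ev_sub] using hvert a ha s hs
  · simpa [eval_marginal, moment_apply, eval_slice, ev_sub] using hh b hb r hr
  · have := hc _ (memQ_aeval_mul_aeval hr hs)
    simp only [ev_aeval_mul_aeval] at this
    simp only [moment_apply, eval_marginal, eval_slice, ev_sub,
      ← intervalIntegral.integral_mul_const]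
    rw [← this]
    congr! 4
    ring

lemma eq_zero_of_apply_marginal {p : ℕ} {q : MvPolynomial (Fin 2) ℝ}
    (hq : memQ p q) (h : ∀ l m, IsDof p l → IsDof p m → l (marginal m q) = 0) : q = 0 := by
  have hs (x : ℝ) : slice q x = 0 := by
    refine eq_zero_of_isDof (natDegree_slice_le hq x) fun m hm => ?_
    rw [← eval_marginal, eq_zero_of_isDof (natDegree_marginal_le hq m) fun l hl => h l m hl hm,
      eval_zero]
  refine MvPolynomial.funext fun z => ?_
  have := eval_slice q (z 0) (z 1)
  rw [hs, eval_zero, ev] at this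
  rw [map_zero, this]
  congr 2
  ext i
  fin_cases i <;> rfl

lemma apply_marginal_eq_zero_of_ev_nodes {p : ℕ} (hp : 2 ≤ p) {t : Fin (p + 1) → ℝ}
    (ht : IsGLNodes p t) {q : MvPolynomial (Fin 2) ℝ} (hq : memQ (p + 1) q)
    (h : ∀ i j, ev q (t i, t j) = 0) {l m : ℝ[X] →ₗ[ℝ] ℝ} (hl : IsDof p l) (hm : IsDof p m) :
    l (marginal m q) = 0 := by
  refine hl.apply_eq_zero_of_eval_nodes hp ht (natDegree_marginal_le hq m) fun i => ?_
  rw [eval_marginal]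
  refine hm.apply_eq_zero_of_eval_nodes hp ht (natDegree_slice_le hq _) fun j => ?_
  rw [eval_slice, h]

end Bivariate

/-- `Î_p v = π̂_p (Î*_{p+1} v)`: the Gauß–Lobatto interpolant into `Q_p(τ̂)` equals the
vertex-edge-cell interpolant of the Lagrange interpolant into `Q_{p+1}(τ̂)` whose nodes
are the `p+1` Gauß–Lobatto nodes together with one extra node `t* ∈ (−1,1)`. -/
theorem gl_eq_vec_of_lagrange_succ (p : ℕ) (hp : 2 ≤ p)
    (t : Fin (p + 1) → ℝ) (ht : IsGLNodes p t)
    (tstar : ℝ) (htstar : tstar ∈ Set.Ioo (-1 : ℝ) 1) (hne : ∀ i, tstar ≠ t i)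
    (v : ℝ × ℝ → ℝ) (hv : ContinuousOn v refSq)
    (qL qp qI : MvPolynomial (Fin 2) ℝ)
    (hqL : IsLag (p + 1) (Fin.snoc t tstar) v qL)
    (hqp : IsVEC p (ev qL) qp)
    (hqI : IsLag p t v qI) :
    qI = qp := by
  have hgrid (i j) : ev (qI - qL) (t i, t j) = 0 := by
    have := hqL.2 i.castSucc j.castSucc
    simp only [Fin.snoc_castSucc] at this
    rw [ev_sub, hqI.2, this, sub_self]
  refine sub_eq_zero.mp (eq_zero_of_apply_marginal (hqI.1.sub hqp.1) fun l m hl hm => ?_)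
  rw [← sub_sub_sub_cancel_right qI qp qL, marginal_sub, map_sub,
    hqp.apply_marginal_sub_eq_zero hl hm,
    apply_marginal_eq_zero_of_ev_nodes hp ht ((hqI.1.mono p.le_succ).sub hqL.1) hgrid hl hm,
    sub_zero]
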